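/- (Nondefectivity of Grassmannian secants.) Let 1 ≤ d ≤ n and set N := d*(n−d)+1. Then the affine cone Gr(d,n) over the Grassmannian in its Plücker embedding satisfies dim Gr(d,n) = N, and for every m ≥ 1 with N * (m + N) ≤ choose n d, the m-th secant variety σ_m Gr(d,n) has dimension exactly m * N. -/

import Mathlib

noncomputable section

/-- The Zariski topology on `ι → ℂ`: a set is closed iff it is the common zero locus
of a family of polynomials in `MvPolynomial ι ℂ`. -/
def zt (ι : Type*) : TopologicalSpace (ι → ℂ) :=
  TopologicalSpace.generateFrom
    { U | ∃ f : MvPolynomial ι ℂ, U = { x | MvPolynomial.eval x f ≠ 0 } }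

def zIsOpen {ι : Type*} (S : Set (ι → ℂ)) : Prop := @IsOpen _ (zt ι) S

def zClosure {ι : Type*} (S : Set (ι → ℂ)) : Set (ι → ℂ) := @closure _ (zt ι) S

/-- The topological Krull dimension of `S` (with the subspace Zariski topology). -/
def zDim {ι : Type*} (S : Set (ι → ℂ)) : WithBot ℕ∞ :=
  @topologicalKrullDim ↥S (TopologicalSpace.induced Subtype.val (zt ι))

/-- The `m`-th secant variety: the Zariski closure of the set of sums of `m` points of `V`. -/
def secant {ι : Type*} (m : ℕ) (V : Set (ι → ℂ)) : Set (ι → ℂ) :=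
  zClosure { p | ∃ x : Fin m → (ι → ℂ), (∀ i, x i ∈ V) ∧ p = ∑ i, x i }

/-- The index type `Λ` of `d`-element subsets of `{0, …, n-1}`; `ℂ^Λ` carries the
Plücker coordinates. -/
def Lam (n d : ℕ) : Type := { S : Finset (Fin n) // S.card = d }

/-- The point of `ℂ^Λ` whose `S`-coordinate is the maximal minor of `M` with row set `S`
(rows taken in increasing order). -/
def plucker {n d : ℕ} (M : Matrix (Fin n) (Fin d) ℂ) : Lam n d → ℂ :=
  fun S => (M.submatrix (fun i : Fin d => ((S.1.orderIsoOfFin S.2) i : Fin n)) id).det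

/-- The affine cone over the Grassmannian in its Plücker embedding: the Zariski closure
of the set of all maximal-minor vectors of `n × d` matrices. -/
def GrassCone (n d : ℕ) : Set (Lam n d → ℂ) :=
  zClosure { p | ∃ M : Matrix (Fin n) (Fin d) ℂ, p = plucker M }

section RingDimension

open Cardinal Algebra

theorem Algebra.IsIntegral.ringKrullDim_eq {R S : Type*} [CommRing R] [CommRing S] [Algebra R S]
    [Algebra.IsIntegral R S] (hinj : Function.Injective (algebraMap R S)) :
    ringKrullDim S = ringKrullDim R := by
  refine le_antisymm ?_ ?_
  · refine Order.krullDim_le_of_strictMono (PrimeSpectrum.comap (algebraMap R S)) ?_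
    intro P Q hPQ
    obtain ⟨hle, x, hxQ, hxP⟩ := SetLike.lt_iff_le_and_exists.mp
      (show P.asIdeal < Q.asIdeal from hPQ)
    exact Ideal.comap_lt_comap_of_integral_mem_sdiff hle ⟨hxQ, hxP⟩
      (Algebra.IsIntegral.isIntegral x)
  · refine iSup_le fun l => ?_
    have : FaithfulSMul R S := (faithfulSMul_iff_algebraMap_injective _ _).mpr hinj
    obtain ⟨P, hP⟩ := Algebra.IsIntegral.comap_surjective R S l.head
    have : P.asIdeal.LiesOver (RelSeries.head l).asIdeal := ⟨by rw [← hP]; rfl⟩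
    obtain ⟨L, hL, -⟩ := Ideal.exists_ltSeries_of_hasGoingUp (S := S) l P.asIdeal
    rw [← hL]
    exact Order.LTSeries.length_le_krullDim L

/-- A finitely generated domain over a field has Krull dimension equal to its
transcendence degree. -/
theorem exists_ringKrullDim_eq_and_trdeg_eq (k : Type) {A : Type} [Field k] [CommRing A]
    [IsDomain A] [Algebra k A] [Algebra.FiniteType k A] :
    ∃ s : ℕ, ringKrullDim A = s ∧ Algebra.trdeg k A = s := by
  obtain ⟨s, g, hg, hint⟩ := exists_integral_inj_algHom_of_fg k A
  refine ⟨s, ?_, ?_⟩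
  · let := g.toRingHom.toAlgebra
    have : Algebra.IsIntegral (MvPolynomial (Fin s) k) A := ⟨hint⟩
    rw [Algebra.IsIntegral.ringKrullDim_eq (R := MvPolynomial (Fin s) k) hg,
      MvPolynomial.ringKrullDim_of_isNoetherianRing]
    simp
  · let := g.toRingHom.toAlgebra
    have : Algebra.IsIntegral (MvPolynomial (Fin s) k) A := ⟨hint⟩
    have : FaithfulSMul (MvPolynomial (Fin s) k) A :=
      (faithfulSMul_iff_algebraMap_injective _ _).mpr hg
    have : IsScalarTower k (MvPolynomial (Fin s) k) A :=
      IsScalarTower.of_algHom g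
    have h := trdeg_add_eq k (MvPolynomial (Fin s) k) (A := A)
    rw [← h, trdeg_eq_zero (R := MvPolynomial (Fin s) k), MvPolynomial.trdeg_of_isDomain]
    simp

theorem ringKrullDim_bounds_of_injective {k A : Type} [Field k] [CommRing A]
    [IsDomain A] [Algebra k A] [Algebra.FiniteType k A] {τ : Type} [Fintype τ] {r : ℕ}
    (f : MvPolynomial (Fin r) k →ₐ[k] A) (hf : Function.Injective f)
    (g : A →ₐ[k] MvPolynomial τ k) (hg : Function.Injective g) :
    (r : WithBot ℕ∞) ≤ ringKrullDim A ∧ ringKrullDim A ≤ (Fintype.card τ : WithBot ℕ∞) := by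
  obtain ⟨s, hs, hs'⟩ := exists_ringKrullDim_eq_and_trdeg_eq k (A := A)
  have h₁ := trdeg_le_of_injective f hf
  have h₂ := trdeg_le_of_injective g hg
  rw [MvPolynomial.trdeg_of_isDomain, hs'] at h₁ h₂
  simp only [lift_uzero, Fintype.card_fin, mk_fintype, Nat.cast_le] at h₁ h₂
  rw [hs]
  exact ⟨by exact_mod_cast h₁, by exact_mod_cast h₂⟩

end RingDimension

section Zariski

open MvPolynomial TopologicalSpace Topology

variable {ι : Type}

theorem isOpen_zt_eval_ne_zero (f : MvPolynomial ι ℂ) :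
    IsOpen[zt ι] {x | eval x f ≠ 0} :=
  isOpen_generateFrom_of_mem ⟨f, rfl⟩

theorem exists_eval_ne_zero_subset_of_isOpen_zt {U : Set (ι → ℂ)} (hU : IsOpen[zt ι] U)
    {x : ι → ℂ} (hx : x ∈ U) :
    ∃ f : MvPolynomial ι ℂ, eval x f ≠ 0 ∧ ∀ y, eval y f ≠ 0 → y ∈ U := by
  induction hU with
  | basic s hs =>
    obtain ⟨f, rfl⟩ := hs
    exact ⟨f, hx, fun _ h => h⟩
  | univ => exact ⟨1, by simp, fun _ _ => trivial⟩
  | inter s t _ _ hs ht =>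
    obtain ⟨f, hf, hf'⟩ := hs hx.1
    obtain ⟨g, hg, hg'⟩ := ht hx.2
    refine ⟨f * g, by simp [hf, hg], fun y hy => ?_⟩
    rw [map_mul] at hy
    exact ⟨hf' y (left_ne_zero_of_mul hy), hg' y (right_ne_zero_of_mul hy)⟩
  | sUnion S _ ih =>
    obtain ⟨s, hs, hxs⟩ := hx
    obtain ⟨f, hf, hf'⟩ := ih s hs hxs
    exact ⟨f, hf, fun y hy => ⟨s, hs, hf' y hy⟩⟩

theorem mem_zClosure_iff {S : Set (ι → ℂ)} {x : ι → ℂ} :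
    x ∈ zClosure S ↔ ∀ f : MvPolynomial ι ℂ, (∀ y ∈ S, eval y f = 0) → eval x f = 0 := by
  rw [zClosure, @mem_closure_iff _ (zt ι)]
  constructor
  · intro h f hf
    by_contra hx
    obtain ⟨y, hy, hyS⟩ := h _ (isOpen_zt_eval_ne_zero f) hx
    exact hy (hf y hyS)
  · intro h U hU hxU
    obtain ⟨f, hf, hfU⟩ := exists_eval_ne_zero_subset_of_isOpen_zt hU hxU
    by_contra hne
    refine hf (h f fun y hy => ?_)
    by_contra hy'
    exact hne ⟨y, hfU y hy', hy⟩

theorem subset_zClosure (S : Set (ι → ℂ)) : S ⊆ zClosure S :=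
  fun x hx => mem_zClosure_iff.2 fun _ h => h x hx

theorem zClosure_zClosure (S : Set (ι → ℂ)) : zClosure (zClosure S) = zClosure S :=
  @closure_closure _ (zt ι) S

variable {V : Set (ι → ℂ)}

/-- The subspace Zariski topology on `V`. -/
abbrev zSubspace (V : Set (ι → ℂ)) : TopologicalSpace V :=
  TopologicalSpace.induced Subtype.val (zt ι)

theorem isClosed_zSubspace_of_family (F : Set (MvPolynomial ι ℂ)) :
    IsClosed[zSubspace V] {x : V | ∀ f ∈ F, eval x.1 f = 0} := by
  have : {x : V | ∀ f ∈ F, eval x.1 f = 0} = ⋂ f ∈ F, {x : V | eval x.1 f = 0} := by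
    ext; simp
  rw [this]
  refine @isClosed_biInter _ _ (zSubspace V) _ _ fun f _ => ?_
  exact @IsClosed.mk _ (zSubspace V) _
    (@isOpen_induced _ _ (zt ι) Subtype.val _ (isOpen_zt_eval_ne_zero f))

theorem exists_eval_ne_zero_subset_of_isOpen_zSubspace {U : Set V} (hU : IsOpen[zSubspace V] U)
    {x : V} (hx : x ∈ U) :
    ∃ f : MvPolynomial ι ℂ, eval x.1 f ≠ 0 ∧ ∀ y : V, eval y.1 f ≠ 0 → y ∈ U := by
  obtain ⟨U', hU', rfl⟩ := hU
  obtain ⟨f, hf, h⟩ := exists_eval_ne_zero_subset_of_isOpen_zt hU' hx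
  exact ⟨f, hf, fun y => h y⟩

theorem mem_of_isClosed_zSubspace {Z : Set V} (hZ : IsClosed[zSubspace V] Z) {x : V}
    (h : ∀ f : MvPolynomial ι ℂ, (∀ y ∈ Z, eval y.1 f = 0) → eval x.1 f = 0) : x ∈ Z := by
  by_contra hx
  obtain ⟨f, hf, hfZ⟩ := exists_eval_ne_zero_subset_of_isOpen_zSubspace hZ.isOpen_compl hx
  refine hf (h f fun y hy => ?_)
  by_contra hy'
  exact hfZ y hy' hy

/-- The polynomials vanishing on a set of points of `V`. -/
def vanishingOn (Z : Set V) : Ideal (MvPolynomial ι ℂ) :=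
  vanishingIdeal ℂ (Subtype.val '' Z)

theorem mem_vanishingOn {Z : Set V} {f : MvPolynomial ι ℂ} :
    f ∈ vanishingOn Z ↔ ∀ y ∈ Z, eval y.1 f = 0 := by
  simp [vanishingOn, mem_vanishingIdeal_iff]

theorem isPrime_vanishingOn {Z : Set V} (hZ : @IsIrreducible _ (zSubspace V) Z) :
    (vanishingOn Z).IsPrime := by
  rw [Ideal.isPrime_iff]
  constructor
  · rw [Ideal.ne_top_iff_one, mem_vanishingOn]
    obtain ⟨x, hx⟩ := hZ.1
    intro h
    simpa using h x hx
  · intro f g hfg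
    by_contra! hne
    simp only [mem_vanishingOn, not_forall] at hne
    obtain ⟨⟨x, hx, hfx⟩, ⟨y, hy, hgy⟩⟩ := hne
    obtain ⟨z, hz, hz'⟩ := hZ.2 {x : V | eval x.1 f ≠ 0} {x : V | eval x.1 g ≠ 0}
      (@isOpen_induced _ _ (zt ι) Subtype.val _ (isOpen_zt_eval_ne_zero f))
      (@isOpen_induced _ _ (zt ι) Subtype.val _ (isOpen_zt_eval_ne_zero g))
      ⟨x, hx, hfx⟩ ⟨y, hy, hgy⟩
    have := mem_vanishingOn.1 hfg z hz
    rw [map_mul] at this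
    exact (mul_ne_zero hz'.1 hz'.2) this

theorem isIrreducible_of_isPrime_vanishingOn {Z : Set V} (hZ : (vanishingOn Z).IsPrime) :
    @IsIrreducible _ (zSubspace V) Z := by
  constructor
  · by_contra hne
    rw [Set.not_nonempty_iff_eq_empty] at hne
    exact hZ.ne_top ((Ideal.eq_top_iff_one _).2 (mem_vanishingOn.2 (by simp [hne])))
  · intro U U' hU hU' ⟨x, hx, hxU⟩ ⟨y, hy, hyU⟩
    obtain ⟨f, hf, hfU⟩ := exists_eval_ne_zero_subset_of_isOpen_zSubspace hU hxU
    obtain ⟨g, hg, hgU⟩ := exists_eval_ne_zero_subset_of_isOpen_zSubspace hU' hyU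
    have hfg : f * g ∉ vanishingOn Z := fun h => (hZ.mem_or_mem h).elim
      (fun h => hf (mem_vanishingOn.1 h x hx)) (fun h => hg (mem_vanishingOn.1 h y hy))
    simp only [mem_vanishingOn, not_forall, map_mul] at hfg
    obtain ⟨z, hz, hz'⟩ := hfg
    exact ⟨z, hz, hfU z (left_ne_zero_of_mul hz'), hgU z (right_ne_zero_of_mul hz')⟩

/-- The topological dimension of a Zariski closed set is the Krull dimension of its
coordinate ring. -/
theorem zDim_eq_ringKrullDim [Finite ι] (hV : zClosure V = V) {A : Type} [CommRing A]
    (ψ : MvPolynomial ι ℂ →+* A) (hψ : Function.Surjective ψ)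
    (hker : ∀ f, ψ f = 0 ↔ ∀ x ∈ V, eval x f = 0) : zDim V = ringKrullDim A := by
  let := zSubspace V
  have hkerle (Z : Set V) : RingHom.ker ψ ≤ vanishingOn Z := fun f hf =>
    mem_vanishingOn.2 fun y _ => (hker f).1 hf y y.2
  have hmem (Z : Set V) (f) : ψ f ∈ (vanishingOn Z).map ψ ↔ f ∈ vanishingOn Z := by
    rw [← Ideal.mem_comap, Ideal.comap_map_of_surjective' ψ hψ, sup_eq_left.2 (hkerle Z)]
  let locus (P : PrimeSpectrum A) : Set V := {x | ∀ f ∈ P.asIdeal.comap ψ, eval x.1 f = 0}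
  have hlocus (P : PrimeSpectrum A) : vanishingOn (locus P) = P.asIdeal.comap ψ := by
    have : Subtype.val '' locus P = zeroLocus ℂ (P.asIdeal.comap ψ) := by
      ext x
      simp only [locus, Set.mem_image, Set.mem_ofPred_eq, mem_zeroLocus_iff]
      constructor
      · rintro ⟨y, hy, rfl⟩ p hp
        exact hy p hp
      · intro h
        refine ⟨⟨x, ?_⟩, h, rfl⟩
        rw [← hV, mem_zClosure_iff]
        intro f hf
        exact h f (by rw [Ideal.mem_comap, (hker f).2 hf]; exact P.asIdeal.zero_mem)
    rw [vanishingOn, this]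
    exact IsPrime.vanishingIdeal_zeroLocus _
  apply le_antisymm
  · rw [ringKrullDim, ← Order.krullDim_orderDual (α := PrimeSpectrum A)]
    refine Order.krullDim_le_of_strictMono (fun Z : IrreducibleCloseds V => OrderDual.toDual
      (⟨(vanishingOn (Z : Set V)).map ψ,
        have := isPrime_vanishingOn Z.isIrreducible
        Ideal.map_isPrime_of_surjective hψ (hkerle _)⟩ : PrimeSpectrum A)) ?_
    intro Z Z' hlt
    rw [OrderDual.toDual_lt_toDual]
    obtain ⟨hle, x, hx, hxZ⟩ := SetLike.lt_iff_le_and_exists.mp hlt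
    refine lt_of_le_not_ge (Ideal.map_mono fun f hf =>
      mem_vanishingOn.2 fun y hy => mem_vanishingOn.1 hf y (hle hy)) fun hge => ?_
    refine hxZ (mem_of_isClosed_zSubspace Z.isClosed fun f hf => ?_)
    have : f ∈ vanishingOn (Z' : Set V) :=
      (hmem _ _).1 (hge ((hmem _ _).2 (mem_vanishingOn.2 hf)))
    exact mem_vanishingOn.1 this x hx
  · rw [ringKrullDim, ← Order.krullDim_orderDual (α := PrimeSpectrum A)]
    refine Order.krullDim_le_of_strictMono (fun P : (PrimeSpectrum A)ᵒᵈ =>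
      (⟨locus (OrderDual.ofDual P),
        isIrreducible_of_isPrime_vanishingOn (by rw [hlocus]; infer_instance),
        isClosed_zSubspace_of_family _⟩ : IrreducibleCloseds V)) ?_
    intro P Q hlt
    have hlt' : (OrderDual.ofDual Q).asIdeal < (OrderDual.ofDual P).asIdeal := hlt
    refine lt_of_le_not_ge (fun x hx f hf => hx f (hlt'.le hf)) fun hge => ?_
    have hsub : locus (OrderDual.ofDual Q) ⊆ locus (OrderDual.ofDual P) := hge
    refine hlt'.not_ge fun a ha => ?_
    obtain ⟨f, rfl⟩ := hψ a
    rw [← Ideal.mem_comap, ← hlocus, mem_vanishingOn] at ha ⊢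
    exact fun y hy => ha y (hsub hy)

end Zariski

section PolyOnLines

/-- A complex function on a complex vector space whose restriction to every line is polynomial. -/
def PolyOnLines {E : Type*} [AddCommGroup E] [Module ℂ E] (F : E → ℂ) : Prop :=
  ∀ x y : E, ∃ p : Polynomial ℂ, ∀ s : ℂ, F (x + s • y) = p.eval s

namespace PolyOnLines

variable {E E' : Type*} [AddCommGroup E] [Module ℂ E] [AddCommGroup E'] [Module ℂ E']
  {F G : E → ℂ}

theorem const (c : ℂ) : PolyOnLines (fun _ : E => c) :=
  fun _ _ => ⟨Polynomial.C c, by simp⟩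

theorem linear (f : E →ₗ[ℂ] ℂ) : PolyOnLines (fun x => f x) :=
  fun x y => ⟨Polynomial.C (f x) + Polynomial.X * Polynomial.C (f y),
    fun s => by simp; ring⟩

theorem add (hF : PolyOnLines F) (hG : PolyOnLines G) : PolyOnLines (fun x => F x + G x) := by
  intro x y
  obtain ⟨p, hp⟩ := hF x y
  obtain ⟨q, hq⟩ := hG x y
  exact ⟨p + q, by simp [hp, hq]⟩

theorem mul (hF : PolyOnLines F) (hG : PolyOnLines G) : PolyOnLines (fun x => F x * G x) := by
  intro x y
  obtain ⟨p, hp⟩ := hF x y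
  obtain ⟨q, hq⟩ := hG x y
  exact ⟨p * q, by simp [hp, hq]⟩

theorem sum {κ : Type*} (s : Finset κ) {F : κ → E → ℂ} (hF : ∀ i ∈ s, PolyOnLines (F i)) :
    PolyOnLines (fun x => ∑ i ∈ s, F i x) := by
  classical
  induction s using Finset.induction_on with
  | empty => simpa using const 0
  | insert a s ha ih =>
    simp only [Finset.sum_insert ha]
    exact (hF a (by simp)).add (ih fun i hi => hF i (by simp [hi]))

theorem prod {κ : Type*} (s : Finset κ) {F : κ → E → ℂ} (hF : ∀ i ∈ s, PolyOnLines (F i)) :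
    PolyOnLines (fun x => ∏ i ∈ s, F i x) := by
  classical
  induction s using Finset.induction_on with
  | empty => simpa using const 1
  | insert a s ha ih =>
    simp only [Finset.prod_insert ha]
    exact (hF a (by simp)).mul (ih fun i hi => hF i (by simp [hi]))

theorem det {κ : Type*} [Fintype κ] [DecidableEq κ] {M : E → Matrix κ κ ℂ}
    (hM : ∀ i j, PolyOnLines (fun x => M x i j)) : PolyOnLines (fun x => (M x).det) := by
  simp only [Matrix.det_apply']
  exact sum _ fun σ _ => (const _).mul (prod _ fun i _ => hM _ _)

theorem eval {κ : Type*} {g : E → κ → ℂ} (hg : ∀ i, PolyOnLines (fun x => g x i))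
    (P : MvPolynomial κ ℂ) : PolyOnLines (fun x => MvPolynomial.eval (g x) P) := by
  induction P using MvPolynomial.induction_on with
  | C a => simpa using const a
  | add p q hp hq => simpa using hp.add hq
  | mul_X p i hp => simpa using hp.mul (hg i)

theorem comp (hF : PolyOnLines F) {A : E' → E}
    (hA : ∀ x y, ∃ u, ∀ s : ℂ, A (x + s • y) = A x + s • u) : PolyOnLines (fun x => F (A x)) := by
  intro x y
  obtain ⟨u, hu⟩ := hA x y
  obtain ⟨p, hp⟩ := hF (A x) u
  exact ⟨p, fun s => by simp only [hu, hp]⟩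

theorem exists_mul_ne_zero (hF : PolyOnLines F) (hG : PolyOnLines G) (hF' : ∃ x, F x ≠ 0)
    (hG' : ∃ x, G x ≠ 0) : ∃ x, F x * G x ≠ 0 := by
  obtain ⟨x, hx⟩ := hF'
  obtain ⟨y, hy⟩ := hG'
  obtain ⟨p, hp⟩ := hF x (y - x)
  obtain ⟨q, hq⟩ := hG x (y - x)
  have hp0 : p ≠ 0 := by
    rintro rfl
    exact hx (by simpa using hp 0)
  have hq0 : q ≠ 0 := by
    rintro rfl
    exact hy (by simpa using hq 1)
  by_contra! h
  refine mul_ne_zero hp0 hq0 (Polynomial.funext fun s => ?_)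
  rw [Polynomial.eval_mul, ← hp, ← hq, h, Polynomial.eval_zero]

theorem eq_zero_of_mul_eq_zero (hF : PolyOnLines F) (hG : PolyOnLines G) (hG' : ∃ x, G x ≠ 0)
    (h : ∀ x, F x * G x = 0) (x : E) : F x = 0 := by
  by_contra hx
  obtain ⟨y, hy⟩ := exists_mul_ne_zero hF hG ⟨x, hx⟩ hG'
  exact hy (h y)

theorem exists_prod_ne_zero {κ : Type*} (s : Finset κ) {F : κ → E → ℂ}
    (hF : ∀ i ∈ s, PolyOnLines (F i)) (hF' : ∀ i ∈ s, ∃ x, F i x ≠ 0) :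
    ∃ x, ∏ i ∈ s, F i x ≠ 0 := by
  classical
  induction s using Finset.induction_on with
  | empty => exact ⟨0, by simp⟩
  | insert a s ha ih =>
    simp only [Finset.prod_insert ha]
    exact exists_mul_ne_zero (hF a (by simp)) (prod _ fun i hi => hF i (by simp [hi]))
      (hF' a (by simp)) (ih (fun i hi => hF i (by simp [hi])) fun i hi => hF' i (by simp [hi]))

end PolyOnLines

end PolyOnLines

section Jacobian

open MvPolynomial

theorem MvPolynomial.sum_mul_eval_pderiv_eq_zero {κ : Type*} [Fintype κ] (P : MvPolynomial κ ℂ)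
    (a b : κ → ℂ) (h : ∀ s : ℂ, eval (a + s • b) P = 0) :
    ∑ i, b i * eval a (pderiv i P) = 0 := by
  classical
  let g : κ → Polynomial ℂ := fun i => Polynomial.C (a i) + Polynomial.X * Polynomial.C (b i)
  have heval (Q : MvPolynomial κ ℂ) (s : ℂ) : (aeval g Q).eval s = eval (a + s • b) Q := by
    induction Q using MvPolynomial.induction_on with
    | C c => simp
    | add p q hp hq => simp [hp, hq]
    | mul_X p i hp =>
      have hi : (g i).eval s = (a + s • b) i := by simp [g]; ring
      rw [map_mul, map_mul, Polynomial.eval_mul, hp, aeval_X, eval_X, hi]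
  have hderiv (Q : MvPolynomial κ ℂ) :
      (Polynomial.derivative (aeval g Q)).eval 0 = ∑ i, b i * eval a (pderiv i Q) := by
    induction Q using MvPolynomial.induction_on with
    | C c => simp
    | add p q hp hq => simp [hp, hq, mul_add, Finset.sum_add_distrib]
    | mul_X p i hp =>
      have h0 := heval p 0
      simp only [zero_smul, add_zero] at h0
      simp only [map_mul, Polynomial.derivative_mul, Polynomial.eval_add, Polynomial.eval_mul, hp,
        h0, aeval_X, pderiv_mul, eval_X, mul_add, Finset.sum_add_distrib, pderiv_X, map_add]
      simp [g, Finset.sum_mul, mul_assoc, Pi.single_apply, apply_ite]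
      ring
  have hzero : aeval g P = 0 := Polynomial.funext fun s => by rw [heval, h, Polynomial.eval_zero]
  rw [← hderiv, hzero]
  simp

theorem MvPolynomial.totalDegree_pderiv_lt {κ : Type*} {P : MvPolynomial κ ℂ} {i : κ}
    (h : pderiv i P ≠ 0) : (pderiv i P).totalDegree < P.totalDegree := by
  classical
  have key (m) (hm : m ∈ (pderiv i P).support) : (m.sum fun _ e => e) < P.totalDegree := by
    rw [mem_support_iff, coeff_pderiv] at hm
    have := le_totalDegree (mem_support_iff.2 (left_ne_zero_of_mul hm))
    rw [Finsupp.sum_add_index' (by simp) (by simp)] at this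
    simp at this
    omega
  obtain ⟨m, hm⟩ := support_nonempty.2 h
  exact (Finset.sup_lt_iff (lt_of_le_of_lt (Nat.zero_le _) (key m hm))).2 key

theorem MvPolynomial.eq_C_of_pderiv_eq_zero {κ : Type*} {P : MvPolynomial κ ℂ}
    (h : ∀ i, pderiv i P = 0) : P = C (coeff 0 P) := by
  classical
  ext m
  rw [coeff_C]
  split_ifs with hm
  · rw [hm]
  · obtain ⟨i, hi⟩ := Finsupp.ne_iff.1 (Ne.symm hm)
    have h' := congrArg (coeff (m - Finsupp.single i 1)) (h i)
    rw [coeff_pderiv, tsub_add_cancel_of_le, coeff_zero, mul_eq_zero] at h'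
    · exact h'.resolve_right (Nat.cast_add_one_ne_zero _)
    · simpa [Nat.one_le_iff_ne_zero] using hi

/-- A polynomial relation among functions `φ` vanishes as soon as the directional derivatives
of `φ`, here encoded by the straight lines in its image, are generically of full rank. -/
theorem eq_zero_of_forall_eval_eq_zero {E κ : Type*} [AddCommGroup E] [Module ℂ E] [Fintype κ]
    (φ : E → κ → ℂ) (hφ : ∀ i, PolyOnLines fun x => φ x i) (F : E → ℂ) (hF : PolyOnLines F)
    (hF' : ∃ x, F x ≠ 0)
    (hspan : ∀ x, F x ≠ 0 →
      Submodule.span ℂ {u : κ → ℂ | ∀ s : ℂ, ∃ y, φ y = φ x + s • u} = ⊤)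
    (P : MvPolynomial κ ℂ) (hP : ∀ x, eval (φ x) P = 0) : P = 0 := by
  classical
  induction hk : P.totalDegree using Nat.strong_induction_on generalizing P with
  | _ k ih =>
  have hder (i : κ) : pderiv i P = 0 := by
    by_contra hne
    refine hne (ih _ (hk ▸ totalDegree_pderiv_lt hne) _ ?_ rfl)
    refine PolyOnLines.eq_zero_of_mul_eq_zero (.eval hφ _) hF hF' fun x => ?_
    by_cases hx : F x = 0
    · simp [hx]
    let L : (κ → ℂ) →ₗ[ℂ] ℂ := ∑ j, (eval (φ x) (pderiv j P)) • LinearMap.proj j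
    have hL : L = 0 := by
      refine LinearMap.ext_on (hspan x hx) fun u hu => ?_
      have := sum_mul_eval_pderiv_eq_zero P (φ x) u fun s => by
        obtain ⟨y, hy⟩ := hu s
        rw [← hy, hP]
      simpa [L, mul_comm] using this
    have := congrArg (fun L => L (Pi.single i 1)) hL
    simp [L, Pi.single_apply] at this
    simp [this]
  have hC := eq_C_of_pderiv_eq_zero hder
  obtain ⟨x, -⟩ := hF'
  have h0 := hP x
  rw [hC, eval_C] at h0
  rw [hC, h0, C_0]

end Jacobian

section SumSets

open MvPolynomial

/-- The set of sums of `m` points of `S`. -/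
def sumSet {ι : Type*} (m : ℕ) (S : Set (ι → ℂ)) : Set (ι → ℂ) :=
  { p | ∃ x : Fin m → (ι → ℂ), (∀ i, x i ∈ S) ∧ p = ∑ i, x i }

theorem zClosure_mono {ι : Type*} {S S' : Set (ι → ℂ)} (h : S ⊆ S') : zClosure S ⊆ zClosure S' :=
  @closure_mono _ (zt ι) _ _ h

theorem sumSet_mono {ι : Type*} {m : ℕ} {S S' : Set (ι → ℂ)} (h : S ⊆ S') :
    sumSet m S ⊆ sumSet m S' := by
  rintro _ ⟨x, hx, rfl⟩
  exact ⟨x, fun i => h (hx i), rfl⟩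

theorem sumSet_zClosure_subset {ι : Type} (m : ℕ) (S : Set (ι → ℂ)) :
    sumSet m (zClosure S) ⊆ zClosure (sumSet m S) := by
  classical
  rintro _ ⟨x, hx, rfl⟩
  rw [mem_zClosure_iff]
  intro f hf
  have key (s : Finset (Fin m)) : ∀ x : Fin m → ι → ℂ,
      (∀ i ∈ s, x i ∈ zClosure S) → (∀ i ∉ s, x i ∈ S) → eval (∑ i, x i) f = 0 := by
    induction s using Finset.induction_on with
    | empty => exact fun x _ hx => hf _ ⟨x, fun i => hx i (by simp), rfl⟩
    | insert a s ha ih =>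
      intro x h₁ h₂
      let c : ι → ℂ := ∑ i ∈ Finset.univ.erase a, x i
      have hc (y : ι → ℂ) : eval (∑ i, Function.update x a y i) f =
          eval y (aeval (fun i => X i + C (c i)) f) := by
        rw [← Finset.add_sum_erase _ _ (Finset.mem_univ a), Function.update_self,
          Finset.sum_congr rfl (g := x) fun i hi =>
            Function.update_of_ne (Finset.ne_of_mem_erase hi) _ _,
          ← coe_aeval_eq_eval, ← coe_aeval_eq_eval, RingHom.coe_coe, RingHom.coe_coe,
          ← AlgHom.comp_apply, comp_aeval]
        congr 2
        ext i
        simp [c]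
      have h := (mem_zClosure_iff.1 (h₁ a (by simp))) (aeval (fun i => X i + C (c i)) f)
        fun y hy => by
          rw [← hc]
          refine ih _ (fun i hi => ?_) fun i hi => ?_
          · rw [Function.update_of_ne (by rintro rfl; exact ha hi)]
            exact h₁ i (by simp [hi])
          · by_cases hia : i = a
            · subst hia
              simpa using hy
            · rw [Function.update_of_ne hia]
              exact h₂ i (by simp [hi, hia])
      rw [← hc, Function.update_eq_self] at h
      exact h
  exact key Finset.univ x (fun i _ => hx i) (by simp)

theorem zClosure_sumSet_eq {ι : Type} {m : ℕ} {S S' : Set (ι → ℂ)} (h : S ⊆ S')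
    (h' : S' ⊆ zClosure S) : zClosure (sumSet m S') = zClosure (sumSet m S) := by
  refine (Set.Subset.antisymm ?_ (zClosure_mono (sumSet_mono h)))
  rw [← zClosure_zClosure (sumSet m S)]
  exact zClosure_mono ((sumSet_mono h').trans (sumSet_zClosure_subset m S))

/-- Dimension bounds for the closure of the image of a polynomial map `g`, the lower one coming
from algebraically independent linear forms `ℓ`. -/
theorem zDim_zClosure_bounds {ι τ : Type} [Fintype ι] [Fintype τ] (S : Set (ι → ℂ))
    (g : ι → MvPolynomial τ ℂ) (hS : S = Set.range fun x i => eval x (g i)) {r : ℕ}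
    (l : Fin r → ι → ℂ)
    (hl : ∀ P : MvPolynomial (Fin r) ℂ,
      (∀ x ∈ S, eval (fun i => ∑ j, l i j * x j) P = 0) → P = 0) :
    (r : WithBot ℕ∞) ≤ zDim (zClosure S) ∧
      zDim (zClosure S) ≤ (Fintype.card τ : WithBot ℕ∞) := by
  let ψ : MvPolynomial ι ℂ →ₐ[ℂ] MvPolynomial τ ℂ := aeval g
  have heval (f : MvPolynomial ι ℂ) (x : τ → ℂ) :
      eval x (ψ f) = eval (fun i => eval x (g i)) f := by
    simp only [ψ, ← coe_aeval_eq_eval, RingHom.coe_coe, ← AlgHom.comp_apply, comp_aeval]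
  have hker (f : MvPolynomial ι ℂ) : ψ f = 0 ↔ ∀ x ∈ S, eval x f = 0 := by
    rw [hS, Set.forall_mem_range]
    simp only [← heval]
    exact ⟨fun h x => by rw [h, map_zero], fun h => MvPolynomial.funext fun x => by simp [h]⟩
  have : Algebra.FiniteType ℂ ψ.range :=
    Algebra.FiniteType.of_surjective ψ.rangeRestrict ψ.rangeRestrict_surjective
  rw [zDim_eq_ringKrullDim (zClosure_zClosure S) (A := ψ.range) ψ.rangeRestrict.toRingHom
    ψ.rangeRestrict_surjective fun f => ?_]
  · let q : MvPolynomial (Fin r) ℂ →ₐ[ℂ] MvPolynomial ι ℂ := aeval fun i => ∑ j, C (l i j) * X j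
    have hq (P : MvPolynomial (Fin r) ℂ) (x : ι → ℂ) :
        eval x (q P) = eval (fun i => ∑ j, l i j * x j) P := by
      simp only [q, ← coe_aeval_eq_eval, RingHom.coe_coe, ← AlgHom.comp_apply, comp_aeval]
      congr 2
      ext i
      simp
    refine ringKrullDim_bounds_of_injective (ψ.rangeRestrict.comp q) ?_ ψ.range.val
      Subtype.val_injective
    rw [injective_iff_map_eq_zero]
    intro P hP
    refine hl P fun x hx => ?_
    rw [← hq]
    exact (hker _).1 (congrArg Subtype.val hP) x hx
  · have h₁ : ψ.rangeRestrict.toRingHom f = 0 ↔ ψ f = 0 := Subtype.ext_iff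
    rw [h₁, hker]
    exact ⟨fun h x hx => mem_zClosure_iff.1 hx f h, fun h x hx => h x (subset_zClosure _ hx)⟩

end SumSets

section Plucker

open MvPolynomial

variable {n d : ℕ}

instance : Fintype (Lam n d) := inferInstanceAs (Fintype { S : Finset (Fin n) // S.card = d })

instance : DecidableEq (Lam n d) :=
  inferInstanceAs (DecidableEq { S : Finset (Fin n) // S.card = d })

theorem card_Lam (n d : ℕ) : Fintype.card (Lam n d) = n.choose d := by
  have h := Fintype.card_finset_len (α := Fin n) d
  rwa [Fintype.card_fin] at h

/-- The increasing enumeration of a `d`-element subset. -/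
def Lam.enum (S : Lam n d) (i : Fin d) : Fin n := S.1.orderIsoOfFin S.2 i

theorem plucker_apply (M : Matrix (Fin n) (Fin d) ℂ) (S : Lam n d) :
    plucker M S = (M.submatrix S.enum id).det := rfl

theorem submatrix_updateCol_id {κ : Type*} (e : κ → Fin n) (M : Matrix (Fin n) (Fin d) ℂ)
    (c : Fin d) (v : Fin n → ℂ) :
    (M.updateCol c v).submatrix e id = (M.submatrix e id).updateCol c (v ∘ e) := by
  ext i j
  simp [Matrix.updateCol_apply]

/-- The Plücker map as a function of one column. -/
def pluckerCol (M : Matrix (Fin n) (Fin d) ℂ) (c : Fin d) : (Fin n → ℂ) →ₗ[ℂ] (Lam n d → ℂ) where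
  toFun v := plucker (M.updateCol c v)
  map_add' v w := by
    ext S
    simp only [plucker_apply, submatrix_updateCol_id, Pi.add_apply]
    exact Matrix.det_updateCol_add _ _ _ _
  map_smul' s v := by
    ext S
    simp only [plucker_apply, submatrix_updateCol_id, Pi.smul_apply]
    exact Matrix.det_updateCol_smul _ _ _ _

theorem pluckerCol_apply (M : Matrix (Fin n) (Fin d) ℂ) (c : Fin d) (v : Fin n → ℂ) :
    pluckerCol M c v = plucker (M.updateCol c v) := rfl

theorem plucker_updateCol_add_smul (M : Matrix (Fin n) (Fin d) ℂ) (c : Fin d) (v : Fin n → ℂ)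
    (s : ℂ) :
    plucker (M.updateCol c ((fun i => M i c) + s • v)) = plucker M + s • pluckerCol M c v := by
  rw [← pluckerCol_apply, map_add, map_smul, pluckerCol_apply]
  congr 2
  exact Matrix.updateCol_eq_self M c

theorem plucker_mul (M : Matrix (Fin n) (Fin d) ℂ) (g : Matrix (Fin d) (Fin d) ℂ) :
    plucker (M * g) = g.det • plucker M := by
  ext S
  rw [Pi.smul_apply, smul_eq_mul, plucker_apply, plucker_apply,
    Matrix.submatrix_mul _ _ _ id _ Function.bijective_id, Matrix.det_mul, mul_comm]
  simp

theorem polyOnLines_plucker (S : Lam n d) :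
    PolyOnLines fun M : Matrix (Fin n) (Fin d) ℂ => plucker M S := by
  simp only [plucker_apply]
  refine .det fun i j => ?_
  exact PolyOnLines.linear (Matrix.entryLinearMap ℂ ℂ (S.enum i) j)

/-- The matrix whose top square block is the identity and whose lower block is `A`. -/
def chartMatrix {R : Type*} [Zero R] [One R] (n d : ℕ) (A : Fin (n - d) × Fin d → R) :
    Matrix (Fin n) (Fin d) R :=
  fun i j => if h : d ≤ i then A (⟨i - d, by omega⟩, j) else if (i : ℕ) = j then 1 else 0

theorem map_chartMatrix {R R' : Type*} [Semiring R] [Semiring R'] (f : R →+* R')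
    (A : Fin (n - d) × Fin d → R) :
    (chartMatrix n d A).map f = chartMatrix n d (fun p => f (A p)) := by
  ext i j
  simp only [Matrix.map_apply, chartMatrix]
  split_ifs <;> simp

/-- The points of the cone lying over the standard affine chart. -/
def chartSet (n d : ℕ) : Set (Lam n d → ℂ) :=
  Set.range fun p : ℂ × (Fin (n - d) × Fin d → ℂ) => p.1 • plucker (chartMatrix n d p.2)

theorem chartSet_subset (hd : 1 ≤ d) : chartSet n d ⊆ Set.range (plucker (n := n) (d := d)) := by
  rintro _ ⟨⟨t, A⟩, rfl⟩
  let D : Matrix (Fin d) (Fin d) ℂ := Matrix.diagonal (Function.update 1 ⟨0, hd⟩ t)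
  refine ⟨chartMatrix n d A * D, ?_⟩
  rw [plucker_mul, Matrix.det_diagonal, Finset.prod_update_of_mem (Finset.mem_univ _)]
  simp

theorem plucker_mem_chartSet (hdn : d ≤ n) {M : Matrix (Fin n) (Fin d) ℂ}
    (hM : (M.submatrix (Fin.castLE hdn) id).det ≠ 0) : plucker M ∈ chartSet n d := by
  set Q := M.submatrix (Fin.castLE hdn) id with hQ
  have hu : IsUnit Q.det := isUnit_iff_ne_zero.2 hM
  refine ⟨⟨Q.det, fun p => (M * Q⁻¹) ⟨d + p.1, by omega⟩ p.2⟩, ?_⟩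
  have h : chartMatrix n d (fun p => (M * Q⁻¹) ⟨d + p.1, by omega⟩ p.2) = M * Q⁻¹ := by
    ext i j
    simp only [chartMatrix]
    split_ifs with h₁ h₂
    · refine congrArg (fun k => (M * Q⁻¹) k j) (Fin.ext ?_)
      simp only
      omega
    all_goals
      have h₃ : (M * Q⁻¹) i j = (Q * Q⁻¹) ⟨i, by omega⟩ j := by
        simp only [Matrix.mul_apply, hQ, Matrix.submatrix_apply, id, Fin.castLE]
      rw [h₃, Matrix.mul_nonsing_inv _ hu, Matrix.one_apply]
      simp [Fin.ext_iff, h₂]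
  simp only [h]
  rw [← plucker_mul, Matrix.mul_assoc, Matrix.nonsing_inv_mul _ hu, Matrix.mul_one]

theorem range_plucker_subset (hdn : d ≤ n) :
    Set.range (plucker (n := n) (d := d)) ⊆ zClosure (chartSet n d) := by
  rintro _ ⟨M, rfl⟩
  rw [mem_zClosure_iff]
  intro f hf
  refine PolyOnLines.eq_zero_of_mul_eq_zero (F := fun M => eval (plucker M) f)
    (G := fun M => (M.submatrix (Fin.castLE hdn) id).det) (.eval polyOnLines_plucker f)
    (.det fun i j => .linear (Matrix.entryLinearMap ℂ ℂ (Fin.castLE hdn i) j))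
    ⟨.of fun i j => if (i : ℕ) = j then 1 else 0, ?_⟩ (fun M => ?_) M
  · have : (Matrix.of fun (i : Fin n) (j : Fin d) => if (i : ℕ) = j then (1 : ℂ) else 0).submatrix
        (Fin.castLE hdn) id = 1 := by
      ext i j
      simp [Matrix.one_apply, Fin.ext_iff]
    rw [this]
    simp
  · by_cases hM : (M.submatrix (Fin.castLE hdn) id).det = 0
    · simp [hM]
    · simp [hf _ (plucker_mem_chartSet hdn hM)]

theorem zClosure_sumSet_chartSet (hd : 1 ≤ d) (hdn : d ≤ n) (m : ℕ) :
    secant m (GrassCone n d) = zClosure (sumSet m (chartSet n d)) := by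
  have h : GrassCone n d = zClosure (chartSet n d) := by
    have : { p | ∃ M : Matrix (Fin n) (Fin d) ℂ, p = plucker M } =
        Set.range (plucker (n := n) (d := d)) := by
      ext p
      simp [eq_comm]
    rw [GrassCone, this]
    refine Set.Subset.antisymm ?_ (zClosure_mono (chartSet_subset hd))
    rw [← zClosure_zClosure (chartSet n d)]
    exact zClosure_mono (range_plucker_subset hdn)
  rw [h]
  exact zClosure_sumSet_eq (subset_zClosure _) subset_rfl

theorem sumSet_one {ι : Type*} (S : Set (ι → ℂ)) : sumSet 1 S = S := by
  ext p
  constructor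
  · rintro ⟨x, hx, rfl⟩
    simpa using hx 0
  · exact fun hp => ⟨fun _ => p, fun _ => hp, by simp⟩

theorem secant_one_grassCone : secant 1 (GrassCone n d) = GrassCone n d := by
  rw [show secant 1 (GrassCone n d) = zClosure (sumSet 1 (GrassCone n d)) from rfl, sumSet_one,
    GrassCone, zClosure_zClosure]

/-- The coordinates of the parametrization of the sums of `m` points over the standard chart. -/
def chartPoly (n d m : ℕ) (S : Lam n d) :
    MvPolynomial (Fin m × Option (Fin (n - d) × Fin d)) ℂ :=
  ∑ i, X (i, none) * ((chartMatrix n d fun p => X (i, some p)).submatrix S.enum id).det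

theorem eval_chartPoly (m : ℕ) (x : Fin m × Option (Fin (n - d) × Fin d) → ℂ) (S : Lam n d) :
    eval x (chartPoly n d m S) =
      (∑ i, x (i, none) • plucker (chartMatrix n d fun p => x (i, some p))) S := by
  simp only [chartPoly, map_sum, map_mul, eval_X, Finset.sum_apply, Pi.smul_apply, smul_eq_mul,
    plucker_apply, RingHom.map_det, RingHom.mapMatrix_apply, ← Matrix.submatrix_map,
    map_chartMatrix]

theorem sumSet_chartSet_eq_range (m : ℕ) :
    sumSet m (chartSet n d) = Set.range fun x S => eval x (chartPoly n d m S) := by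
  simp only [eval_chartPoly]
  ext p
  constructor
  · rintro ⟨x, hx, rfl⟩
    choose y hy using hx
    refine ⟨fun q => q.2.elim (y q.1).1 (y q.1).2, ?_⟩
    ext S
    simp [← hy]
  · rintro ⟨x, rfl⟩
    exact ⟨_, fun i => ⟨⟨x (i, none), fun p => x (i, some p)⟩, rfl⟩, rfl⟩

/-- Dimension bounds for the secant varieties of the cone over the Grassmannian. -/
theorem zDim_secant_bounds (hd : 1 ≤ d) (hdn : d ≤ n) (m : ℕ) {r : ℕ}
    (l : Fin r → Lam n d → ℂ)
    (hl : ∀ P : MvPolynomial (Fin r) ℂ, (∀ M : Fin m → Matrix (Fin n) (Fin d) ℂ,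
      eval (fun i => ∑ j, l i j * (∑ k, plucker (M k)) j) P = 0) → P = 0) :
    (r : WithBot ℕ∞) ≤ zDim (secant m (GrassCone n d)) ∧
      zDim (secant m (GrassCone n d)) ≤ ((m * (d * (n - d) + 1) : ℕ) : WithBot ℕ∞) := by
  rw [zClosure_sumSet_chartSet hd hdn]
  have h := zDim_zClosure_bounds _ (chartPoly n d m) (sumSet_chartSet_eq_range m) l ?_
  · simpa [mul_comm d] using h
  · intro P hP
    refine hl P fun M => ?_
    have hmem : ∑ k, plucker (M k) ∈ zClosure (sumSet m (chartSet n d)) :=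
      sumSet_zClosure_subset _ _ ⟨_, fun i => range_plucker_subset hdn ⟨M i, rfl⟩, rfl⟩
    have := mem_zClosure_iff.1 hmem (aeval (fun i => ∑ j, C (l i j) * X j) P)
    have hq (x : Lam n d → ℂ) : eval x (aeval (fun i => ∑ j, C (l i j) * X j) P) =
        eval (fun i => ∑ j, l i j * x j) P := by
      simp only [← coe_aeval_eq_eval, RingHom.coe_coe, ← AlgHom.comp_apply, comp_aeval]
      congr 2
      ext i
      simp
    simp only [hq] at this
    exact this hP

end Plucker

section Tangent

open MvPolynomial Module

variable {n d : ℕ}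

/-- The differential of the Plücker map at `M`; directions are given column by column. -/
def dPlucker (M : Matrix (Fin n) (Fin d) ℂ) : (Fin d → Fin n → ℂ) →ₗ[ℂ] (Lam n d → ℂ) :=
  ∑ c, pluckerCol M c ∘ₗ LinearMap.proj c

theorem dPlucker_apply (M : Matrix (Fin n) (Fin d) ℂ) (q : Fin d → Fin n → ℂ) :
    dPlucker M q = ∑ c, plucker (M.updateCol c (q c)) := by
  simp [dPlucker, pluckerCol_apply]

theorem pluckerCol_mem_range (M : Matrix (Fin n) (Fin d) ℂ) (c : Fin d) (v : Fin n → ℂ) :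
    pluckerCol M c v ∈ LinearMap.range (dPlucker M) := by
  classical
  refine ⟨Pi.single c v, ?_⟩
  rw [dPlucker, LinearMap.sum_apply, Finset.sum_eq_single c]
  · simp
  · intro b _ hb
    simp [hb]
  · simp

/-- The span of the tangent spaces at the points of `z` indexed by `A`. -/
def tangentJoin (A : Finset ℕ) (z : ℕ → Matrix (Fin n) (Fin d) ℂ) : Submodule ℂ (Lam n d → ℂ) :=
  ⨆ i ∈ A, LinearMap.range (dPlucker (z i))

theorem mem_tangentJoin {A : Finset ℕ} {z : ℕ → Matrix (Fin n) (Fin d) ℂ} {v : Lam n d → ℂ} :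
    v ∈ tangentJoin A z ↔ ∃ q : ℕ → Fin d → Fin n → ℂ, v = ∑ i ∈ A, dPlucker (z i) (q i) := by
  rw [tangentJoin, Submodule.mem_iSup_finset_iff_exists_sum]
  constructor
  · rintro ⟨μ, rfl⟩
    choose q hq using fun i => (μ i).2
    exact ⟨q, by simp [hq]⟩
  · rintro ⟨q, rfl⟩
    exact ⟨fun i => ⟨_, q i, rfl⟩, rfl⟩

theorem tangentJoin_le {A : Finset ℕ} {z : ℕ → Matrix (Fin n) (Fin d) ℂ}
    {W : Submodule ℂ (Lam n d → ℂ)} (h : ∀ i ∈ A, ∀ c v, pluckerCol (z i) c v ∈ W) :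
    tangentJoin A z ≤ W := by
  refine iSup₂_le fun i hi => ?_
  rintro _ ⟨q, rfl⟩
  rw [dPlucker_apply]
  exact Submodule.sum_mem _ fun c _ => h i hi c (q c)

theorem pluckerCol_mem_tangentJoin {A : Finset ℕ} (z : ℕ → Matrix (Fin n) (Fin d) ℂ) {i : ℕ}
    (hi : i ∈ A) (c : Fin d) (v : Fin n → ℂ) : pluckerCol (z i) c v ∈ tangentJoin A z :=
  le_iSup₂ (f := fun i (_ : i ∈ A) => LinearMap.range (dPlucker (z i))) i hi
    (pluckerCol_mem_range _ _ _)

theorem tangentJoin_mono {A B : Finset ℕ} (h : A ⊆ B) (z : ℕ → Matrix (Fin n) (Fin d) ℂ) :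
    tangentJoin A z ≤ tangentJoin B z :=
  tangentJoin_le fun _ hi c v => pluckerCol_mem_tangentJoin z (h hi) c v

theorem tangentJoin_union (A B : Finset ℕ) (z : ℕ → Matrix (Fin n) (Fin d) ℂ) :
    tangentJoin (A ∪ B) z = tangentJoin A z ⊔ tangentJoin B z := by
  simp only [tangentJoin, Finset.mem_union, iSup_or, iSup_sup_eq]

theorem tangentJoin_image (A : Finset ℕ) (e : ℕ → ℕ) (z : ℕ → Matrix (Fin n) (Fin d) ℂ) :
    tangentJoin (A.image e) z = tangentJoin A (fun i => z (e i)) := by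
  simp only [tangentJoin, Finset.iSup_finset_image]

theorem Finset.exists_image_eq_of_card_eq {A B : Finset ℕ} (h : A.card = B.card) :
    ∃ e : ℕ → ℕ, A.image e = B := by
  let e := Finset.equivOfCardEq h
  refine ⟨fun i => if h : i ∈ A then e ⟨i, h⟩ else 0, ?_⟩
  ext j
  simp only [Finset.mem_image]
  constructor
  · rintro ⟨i, hi, rfl⟩
    simp [hi]
  · intro hj
    exact ⟨e.symm ⟨j, hj⟩, by simp, by simp⟩

/-- The rank of the span of `k` generic tangent spaces. -/
def genRank (n d k : ℕ) : ℕ :=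
  ⨆ z : ℕ → Matrix (Fin n) (Fin d) ℂ, finrank ℂ (tangentJoin (Finset.range k) z)

theorem bddAbove_finrank_tangentJoin (A : Finset ℕ) :
    BddAbove (Set.range fun z : ℕ → Matrix (Fin n) (Fin d) ℂ => finrank ℂ (tangentJoin A z)) :=
  ⟨finrank ℂ (Lam n d → ℂ), by rintro _ ⟨z, rfl⟩; exact Submodule.finrank_le _⟩

theorem finrank_tangentJoin_le (A : Finset ℕ) (z : ℕ → Matrix (Fin n) (Fin d) ℂ) :
    finrank ℂ (tangentJoin A z) ≤ genRank n d A.card := by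
  obtain ⟨e, he⟩ := Finset.exists_image_eq_of_card_eq (A := Finset.range A.card) (B := A) (by simp)
  conv_lhs => rw [← he, tangentJoin_image]
  exact le_ciSup (bddAbove_finrank_tangentJoin _) (fun i => z (e i))

theorem exists_finrank_tangentJoin_eq (n d : ℕ) (A : Finset ℕ) :
    ∃ z : ℕ → Matrix (Fin n) (Fin d) ℂ, finrank ℂ (tangentJoin A z) = genRank n d A.card := by
  obtain ⟨e, he⟩ := Finset.exists_image_eq_of_card_eq (A := A) (B := Finset.range A.card) (by simp)
  obtain ⟨z, hz⟩ := Nat.sSup_mem (Set.range_nonempty _)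
    (bddAbove_finrank_tangentJoin (n := n) (d := d) (Finset.range A.card))
  refine ⟨fun i => z (e i), ?_⟩
  rw [← tangentJoin_image, he]
  exact hz

theorem genRank_le_choose (n d k : ℕ) : genRank n d k ≤ n.choose d := by
  refine ciSup_le fun z => (Submodule.finrank_le _).trans ?_
  rw [finrank_fintype_fun_eq_card, card_Lam]

theorem PolyOnLines.linear_comp {E κ : Type*} [AddCommGroup E] [Module ℂ E] [Fintype κ]
    (L : (κ → ℂ) →ₗ[ℂ] ℂ) {g : E → κ → ℂ} (hg : ∀ i, PolyOnLines fun x => g x i) :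
    PolyOnLines fun x => L (g x) := by
  classical
  rw [funext fun x => L.pi_apply_eq_sum_univ (g x)]
  exact .sum _ fun i _ => (hg i).mul (.const _)

theorem polyOnLines_plucker_updateCol (S : Lam n d) (p : ℕ) (c : Fin d) (v : Fin n → ℂ) :
    PolyOnLines fun z : ℕ → Matrix (Fin n) (Fin d) ℂ => plucker ((z p).updateCol c v) S := by
  refine (polyOnLines_plucker S).comp (A := fun z : ℕ → Matrix (Fin n) (Fin d) ℂ =>
    (z p).updateCol c v) fun x y => ⟨(y p).updateCol c 0, fun s => ?_⟩
  ext i j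
  by_cases h : j = c <;> simp [h]

/-- The generic rank of the span of tangent spaces is attained off the zero locus of a nonzero
polynomial, and detected by fixed linear forms. -/
theorem exists_polyOnLines_map_tangentJoin_eq_top (n d : ℕ) (A : Finset ℕ) :
    ∃ (l : (Lam n d → ℂ) →ₗ[ℂ] (Fin (genRank n d A.card) → ℂ))
      (F : (ℕ → Matrix (Fin n) (Fin d) ℂ) → ℂ), PolyOnLines F ∧ (∃ z, F z ≠ 0) ∧
      ∀ z, F z ≠ 0 → (tangentJoin A z).map l = ⊤ := by
  obtain ⟨z₀, hz₀⟩ := exists_finrank_tangentJoin_eq n d A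
  let b := finBasisOfFinrankEq ℂ _ hz₀
  obtain ⟨l, hl⟩ := b.equivFun.toLinearMap.exists_extend
  choose q hq using fun j => mem_tangentJoin.1 (b j : tangentJoin A z₀).2
  let w (z : ℕ → Matrix (Fin n) (Fin d) ℂ) (j : Fin (genRank n d A.card)) : Lam n d → ℂ :=
    ∑ p ∈ A, dPlucker (z p) (q j p)
  let G (z : ℕ → Matrix (Fin n) (Fin d) ℂ) :
      Matrix (Fin (genRank n d A.card)) (Fin (genRank n d A.card)) ℂ := .of fun i j => l (w z j) i
  refine ⟨l, fun z => (G z).det, .det fun i j => ?_, ⟨z₀, ?_⟩, fun z hz => ?_⟩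
  · refine PolyOnLines.linear_comp (LinearMap.proj (R := ℂ) (φ := fun _ => ℂ) i ∘ₗ l) fun S => ?_
    simp only [w, dPlucker_apply, Finset.sum_apply]
    exact .sum _ fun p _ => .sum _ fun c _ => polyOnLines_plucker_updateCol _ _ _ _
  · have : G z₀ = 1 := by
      ext i j
      have h := congrArg (fun f => f (b j) i) hl
      simp only [LinearMap.comp_apply, Submodule.subtype_apply, LinearEquiv.coe_coe,
        Basis.equivFun_self] at h
      simp only [G, Matrix.of_apply, w, ← hq, h, Matrix.one_apply, eq_comm]
    simp [this]
  · rw [Submodule.eq_top_iff']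
    intro y
    refine ⟨∑ j, ((G z)⁻¹.mulVec y) j • w z j,
      Submodule.sum_mem _ fun j _ => Submodule.smul_mem _ _ (mem_tangentJoin.2 ⟨_, rfl⟩), ?_⟩
    have h : l (∑ j, ((G z)⁻¹.mulVec y) j • w z j) = (G z).mulVec ((G z)⁻¹.mulVec y) := by
      ext i
      simp [Matrix.mulVec, dotProduct, G, mul_comm]
    rw [h, Matrix.mulVec_mulVec, Matrix.mul_nonsing_inv _ (isUnit_iff_ne_zero.2 hz),
      Matrix.one_mulVec]

theorem exists_polyOnLines_finrank_tangentJoin_eq (n d : ℕ) (A : Finset ℕ) :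
    ∃ F : (ℕ → Matrix (Fin n) (Fin d) ℂ) → ℂ, PolyOnLines F ∧ (∃ z, F z ≠ 0) ∧
      ∀ z, F z ≠ 0 → finrank ℂ (tangentJoin A z) = genRank n d A.card := by
  obtain ⟨l, F, hF, hF', h⟩ := exists_polyOnLines_map_tangentJoin_eq_top n d A
  refine ⟨F, hF, hF', fun z hz => (finrank_tangentJoin_le A z).antisymm ?_⟩
  have := Submodule.finrank_map_le l (tangentJoin A z)
  rwa [h z hz, finrank_top, finrank_fin_fun] at this

theorem zDim_secant_mem_Icc (hd : 1 ≤ d) (hdn : d ≤ n) (m : ℕ) :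
    (genRank n d m : WithBot ℕ∞) ≤ zDim (secant m (GrassCone n d)) ∧
      zDim (secant m (GrassCone n d)) ≤ ((m * (d * (n - d) + 1) : ℕ) : WithBot ℕ∞) := by
  classical
  obtain ⟨l, F, hF, hF', h⟩ := exists_polyOnLines_map_tangentJoin_eq_top n d (Finset.range m)
  have hr : genRank n d m = genRank n d (Finset.range m).card := by simp
  rw [hr]
  refine zDim_secant_bounds hd hdn m (fun i j => l (Pi.single j 1) i) fun P hP => ?_
  let φ (z : ℕ → Matrix (Fin n) (Fin d) ℂ) := l (∑ p ∈ Finset.range m, plucker (z p))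
  refine eq_zero_of_forall_eval_eq_zero φ (fun i => ?_) F hF hF' (fun z hz => ?_) P fun z => ?_
  · refine PolyOnLines.linear_comp (LinearMap.proj (R := ℂ) (φ := fun _ => ℂ) i ∘ₗ l) fun S => ?_
    simp only [Finset.sum_apply]
    exact .sum _ fun p _ => (polyOnLines_plucker S).comp fun x y => ⟨y p, fun s => rfl⟩
  · rw [eq_top_iff, ← h z hz, Submodule.map_le_iff_le_comap]
    refine tangentJoin_le fun p hp c v => Submodule.subset_span fun s => ?_
    refine ⟨Function.update z p ((z p).updateCol c ((fun i => z p i c) + s • v)), ?_⟩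
    simp only [φ]
    rw [← map_smul, ← map_add, ← Finset.add_sum_erase _ _ hp, ← Finset.add_sum_erase _ _ hp,
      Function.update_self, plucker_updateCol_add_smul,
      Finset.sum_congr rfl fun i hi => by rw [Function.update_of_ne (Finset.ne_of_mem_erase hi)]]
    congr 1
    abel
  · rw [← hP fun k => z k]
    congr 2
    ext i
    have := LinearMap.pi_apply_eq_sum_univ (LinearMap.proj i ∘ₗ l)
      (∑ p ∈ Finset.range m, plucker (z p))
    simp only [LinearMap.comp_apply, LinearMap.proj_apply] at this
    rw [Finset.sum_range (fun p => plucker (z p))] at this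
    simp only [φ, Finset.sum_range (fun p => plucker (z p)), this, smul_eq_mul, mul_comm]
    refine Finset.sum_congr rfl fun j _ => ?_
    have hj : (Pi.single j 1 : Lam n d → ℂ) = fun S => if j = S then 1 else 0 := by
      ext S
      simp [Pi.single_apply, eq_comm]
    rw [hj]

theorem genRank_le_mul (hd : 1 ≤ d) (hdn : d ≤ n) (m : ℕ) :
    genRank n d m ≤ m * (d * (n - d) + 1) := by
  have h := zDim_secant_mem_Icc hd hdn m
  exact_mod_cast h.1.trans h.2

end Tangent

section GenericRank

open Module

variable {n d : ℕ}

theorem Lam.enum_mem (S : Lam n d) (i : Fin d) : S.enum i ∈ S.1 :=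
  (S.1.orderIsoOfFin S.2 i).2

theorem Lam.exists_perm (S : Lam n d) {f : Fin d → Fin n} (hf : Function.Injective f)
    (hS : ∀ i, f i ∈ S.1) : ∃ π : Equiv.Perm (Fin d), ∀ i, f i = S.enum (π i) := by
  let g (i : Fin d) : Fin d := (S.1.orderIsoOfFin S.2).symm ⟨f i, hS i⟩
  have hg : Function.Injective g := fun i j hij => by
    simpa [g, hf.eq_iff] using hij
  refine ⟨Equiv.ofBijective g (Finite.injective_iff_bijective.1 hg), fun i => ?_⟩
  simp [g, Lam.enum]

/-- The matrix whose columns are the standard basis vectors indexed by `f`. -/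
def stdColumns (f : Fin d → Fin n) : Matrix (Fin n) (Fin d) ℂ :=
  .of fun i j => if i = f j then 1 else 0

theorem plucker_stdColumns_of_mem {f : Fin d → Fin n} (hf : Function.Injective f) {S : Lam n d}
    (hS : ∀ i, f i ∈ S.1) : plucker (stdColumns f) S ≠ 0 := by
  obtain ⟨π, hπ⟩ := S.exists_perm hf hS
  have hinj : Function.Injective S.enum := fun i j hij => by
    simpa [Lam.enum, Subtype.val_inj] using hij
  have h : (stdColumns f).submatrix S.enum id = (1 : Matrix (Fin d) (Fin d) ℂ).submatrix id π := by
    ext i j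
    simp [stdColumns, hπ, Matrix.one_apply, hinj.eq_iff]
  rw [plucker_apply, h, Matrix.det_permute']
  simp

theorem plucker_stdColumns_of_notMem {f : Fin d → Fin n} {S : Lam n d} {j : Fin d}
    (hS : f j ∉ S.1) : plucker (stdColumns f) S = 0 := by
  rw [plucker_apply]
  refine Matrix.det_eq_zero_of_column_eq_zero j fun i => ?_
  have : S.enum i ≠ f j := fun h => hS (h ▸ S.enum_mem i)
  simp [stdColumns, this]

/-- The `d`-element range of an injective map. -/
def Lam.ofInjective (f : Fin d → Fin n) (hf : Function.Injective f) : Lam n d :=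
  ⟨Finset.univ.image f, by rw [Finset.card_image_of_injective _ hf]; simp⟩

theorem Lam.eq_of_subset {S S' : Lam n d} (h : S.1 ⊆ S'.1) : S = S' :=
  Subtype.ext (Finset.eq_of_subset_of_card_le h (by rw [S.2, S'.2]))

theorem single_mem_of_plucker_stdColumns_mem {W : Submodule ℂ (Lam n d → ℂ)} {f : Fin d → Fin n}
    (hf : Function.Injective f) (h : plucker (stdColumns f) ∈ W) :
    Pi.single (Lam.ofInjective f hf) 1 ∈ W := by
  have h₁ : plucker (stdColumns f) (Lam.ofInjective f hf) ≠ 0 :=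
    plucker_stdColumns_of_mem hf fun i => by simp [Lam.ofInjective]
  have h₂ : Pi.single (Lam.ofInjective f hf) 1 =
      (plucker (stdColumns f) (Lam.ofInjective f hf))⁻¹ • plucker (stdColumns f) := by
    ext S
    by_cases hS : S = Lam.ofInjective f hf
    · subst hS
      simp [h₁]
    · have : ∃ j, f j ∉ S.1 := by
        by_contra! hc
        refine hS (Lam.eq_of_subset ?_).symm
        intro i hi
        obtain ⟨j, -, rfl⟩ := Finset.mem_image.1 hi
        exact hc j
      obtain ⟨j, hj⟩ := this
      simp [hS, plucker_stdColumns_of_notMem hj]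
  rw [h₂]
  exact W.smul_mem _ h

theorem stdColumns_updateCol (f : Fin d → Fin n) (c : Fin d) (i : Fin n) :
    (stdColumns f).updateCol c (Pi.single i 1) = stdColumns (Function.update f c i) := by
  ext a b
  by_cases h : b = c
  · subst h
    simp [stdColumns, Pi.single_apply]
  · simp [stdColumns, h]

/-- The coordinate embedding of `Fin d` into `Fin n`, modified in at most one place by a value
outside its range. -/
def chartIndex (hdn : d ≤ n) : Option (Fin (n - d) × Fin d) → Fin d → Fin n
  | none => Fin.castLE hdn
  | some p => Function.update (Fin.castLE hdn) p.2 ⟨d + p.1, by omega⟩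

theorem chartIndex_injective (hdn : d ≤ n) (a : Option (Fin (n - d) × Fin d)) :
    Function.Injective (chartIndex hdn a) := by
  cases a with
  | none => exact Fin.castLE_injective hdn
  | some p =>
    intro i j hij
    simp only [chartIndex, Function.update_apply, Fin.ext_iff] at hij ⊢
    split_ifs at hij <;> simp_all <;> omega

theorem ofInjective_chartIndex_injective (hdn : d ≤ n) :
    Function.Injective fun a => Lam.ofInjective _ (chartIndex_injective hdn a) := by
  intro a b hab
  have hab : Finset.univ.image (chartIndex hdn a) = Finset.univ.image (chartIndex hdn b) :=
    congrArg Subtype.val hab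
  have key (p : Fin (n - d) × Fin d) (b) (h : Finset.univ.image (chartIndex hdn (some p)) =
      Finset.univ.image (chartIndex hdn b)) : b = some p := by
    have h₁ : (⟨d + p.1, by omega⟩ : Fin n) ∈ Finset.univ.image (chartIndex hdn b) := by
      rw [← h]
      exact Finset.mem_image.2 ⟨p.2, by simp, by simp [chartIndex]⟩
    obtain ⟨j, -, hj⟩ := Finset.mem_image.1 h₁
    cases b with
    | none => simp [chartIndex, Fin.ext_iff] at hj; omega
    | some q =>
      simp only [chartIndex, Function.update_apply, Fin.ext_iff] at hj
      have hq : q.1 = p.1 := by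
        split_ifs at hj
        · simp at hj
          omega
        · simp at hj
          omega
      have h₂ : q.2 = p.2 := by
        by_contra hne
        have h₃ : Fin.castLE hdn p.2 ∈ Finset.univ.image (chartIndex hdn (some p)) := by
          rw [h]
          exact Finset.mem_image.2 ⟨p.2, by simp, by simp [chartIndex, Ne.symm hne]⟩
        obtain ⟨j, -, hj⟩ := Finset.mem_image.1 h₃
        simp only [chartIndex, Function.update_apply, Fin.ext_iff] at hj
        split_ifs at hj <;> simp_all
        omega
      rw [← Prod.mk.eta (p := p), ← Prod.mk.eta (p := q), hq, h₂]
  cases a with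
  | some p => exact (key p b hab).symm
  | none =>
    cases b with
    | none => rfl
    | some p => exact key p none hab.symm

theorem le_genRank_one (hd : 1 ≤ d) (hdn : d ≤ n) : d * (n - d) + 1 ≤ genRank n d 1 := by
  let M := stdColumns (Fin.castLE hdn)
  let W := tangentJoin {0} fun _ => M
  have hmem (a) : plucker (stdColumns (chartIndex hdn a)) ∈ W := by
    cases a with
    | none =>
      have h := pluckerCol_mem_tangentJoin (A := {0}) (fun _ => M) (Finset.mem_singleton_self 0)
        ⟨0, hd⟩ (fun i => M i ⟨0, hd⟩)
      rw [pluckerCol_apply] at h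
      convert h
      exact (Matrix.updateCol_eq_self M _).symm
    | some p =>
      have h := pluckerCol_mem_tangentJoin (A := {0}) (fun _ => M) (Finset.mem_singleton_self 0)
        p.2 (Pi.single ⟨d + p.1, by omega⟩ 1)
      rwa [pluckerCol_apply, stdColumns_updateCol] at h
  have hli : LinearIndependent ℂ fun a => (⟨_, single_mem_of_plucker_stdColumns_mem
      (chartIndex_injective hdn a) (hmem a)⟩ : W) := by
    refine LinearIndependent.of_comp W.subtype ?_
    exact (Pi.linearIndependent_single_one (Lam n d) ℂ).comp _
      (ofInjective_chartIndex_injective hdn)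
  have := hli.fintype_card_le_finrank.trans (finrank_tangentJoin_le {0} _)
  simpa [mul_comm d] using this

theorem genRank_one (hd : 1 ≤ d) (hdn : d ≤ n) : genRank n d 1 = d * (n - d) + 1 :=
  le_antisymm (by simpa using genRank_le_mul hd hdn 1) (le_genRank_one hd hdn)

/-- Simultaneous genericity with respect to a finite family of index sets. -/
theorem exists_polyOnLines_forall_finrank_eq (n d : ℕ) (𝒜 : Finset (Finset ℕ)) :
    ∃ F : (ℕ → Matrix (Fin n) (Fin d) ℂ) → ℂ, PolyOnLines F ∧ (∃ z, F z ≠ 0) ∧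
      ∀ z, F z ≠ 0 → ∀ A ∈ 𝒜, finrank ℂ (tangentJoin A z) = genRank n d A.card := by
  choose F hF hF' h using exists_polyOnLines_finrank_tangentJoin_eq n d
  exact ⟨fun z => ∏ A ∈ 𝒜, F A z, .prod _ fun A _ => hF A,
    PolyOnLines.exists_prod_ne_zero _ (fun A _ => hF A) fun A _ => hF' A,
    fun z hz A hA => h A z (Finset.prod_ne_zero_iff.1 hz A hA)⟩

theorem genRank_concave (n d k : ℕ) :
    genRank n d (k + 2) + genRank n d k ≤ 2 * genRank n d (k + 1) := by
  obtain ⟨F, -, ⟨z, hz⟩, hF⟩ :=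
    exists_polyOnLines_forall_finrank_eq n d {Finset.range (k + 2), Finset.range k}
  have h₁ := hF z hz (Finset.range (k + 2)) (by simp)
  have h₂ := hF z hz (Finset.range k) (by simp)
  have hA : insert k (Finset.range k) ∪ insert (k + 1) (Finset.range k) = Finset.range (k + 2) := by
    ext i
    simp
    omega
  have h₃ := Submodule.finrank_sup_add_finrank_inf_eq
    (tangentJoin (insert k (Finset.range k)) z) (tangentJoin (insert (k + 1) (Finset.range k)) z)
  have h₄ := Submodule.finrank_mono (le_inf
    (tangentJoin_mono (Finset.subset_insert k (Finset.range k)) z)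
    (tangentJoin_mono (Finset.subset_insert (k + 1) (Finset.range k)) z))
  have h₅ := finrank_tangentJoin_le (insert k (Finset.range k)) z
  have h₆ := finrank_tangentJoin_le (insert (k + 1) (Finset.range k)) z
  rw [← tangentJoin_union, hA, h₁] at h₃
  rw [Finset.card_insert_of_notMem (by simp)] at h₅ h₆
  simp only [Finset.card_range] at *
  omega

end GenericRank

section Monomial

variable {n d : ℕ}

/-- The action of a permutation on `d`-element subsets. -/
def Lam.perm (σ : Equiv.Perm (Fin n)) (S : Lam n d) : Lam n d :=
  ⟨S.1.map σ.toEmbedding, by rw [Finset.card_map, S.2]⟩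

theorem Lam.perm_bijective (σ : Equiv.Perm (Fin n)) :
    Function.Bijective (Lam.perm (d := d) σ) :=
  Finite.injective_iff_bijective.1 fun _ _ h =>
    Subtype.ext (Finset.map_injective _ (congrArg Subtype.val h))

theorem Lam.exists_perm_eq (S S' : Lam n d) : ∃ σ, Lam.perm σ S = S' := by
  let e : { x // x ∈ S.1 } ≃ { x // x ∈ S'.1 } := Finset.equivOfCardEq (by rw [S.2, S'.2])
  refine ⟨e.extendSubtype, Lam.eq_of_subset fun i hi => ?_⟩
  obtain ⟨j, hj, rfl⟩ := Finset.mem_map.1 hi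
  exact e.extendSubtype_mem j hj

/-- Permuting and rescaling the rows of a matrix. -/
def rowMonomial (σ : Equiv.Perm (Fin n)) (t : Fin n → ℂ) (M : Matrix (Fin n) (Fin d) ℂ) :
    Matrix (Fin n) (Fin d) ℂ :=
  .of fun i j => t i * M (σ i) j

theorem exists_plucker_rowMonomial (σ : Equiv.Perm (Fin n)) (S : Lam n d) :
    ∃ ε : ℂ, ε ≠ 0 ∧ ∀ t (M : Matrix (Fin n) (Fin d) ℂ),
      plucker (rowMonomial σ t M) S = (∏ i ∈ S.1, t i) * (ε * plucker M (S.perm σ)) := by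
  have hinj : Function.Injective S.enum := fun i j hij => by
    simpa [Lam.enum, Subtype.val_inj] using hij
  obtain ⟨π, hπ⟩ := (S.perm σ).exists_perm (f := fun i => σ (S.enum i))
    (σ.injective.comp hinj) fun i => Finset.mem_map_of_mem _ (S.enum_mem i)
  refine ⟨(Equiv.Perm.sign π : ℤ), by simp, fun t M => ?_⟩
  have h : (rowMonomial σ t M).submatrix S.enum id =
      .of fun i j => t (S.enum i) * (M.submatrix (S.perm σ).enum id).submatrix π id i j := by
    ext i j
    simp [rowMonomial, hπ]
  rw [plucker_apply, h, Matrix.det_mul_column, Matrix.det_permute, plucker_apply]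
  congr 1
  rw [← Finset.prod_coe_sort S.1 t]
  exact (Equiv.prod_comp (S.1.orderIsoOfFin S.2).toEquiv fun i : S.1 => t i)

theorem rowMonomial_updateCol (σ : Equiv.Perm (Fin n)) {t : Fin n → ℂ} (ht : ∀ i, t i ≠ 0)
    (M : Matrix (Fin n) (Fin d) ℂ) (c : Fin d) (v : Fin n → ℂ) :
    (rowMonomial σ t M).updateCol c v =
      rowMonomial σ t (M.updateCol c fun i => (t (σ.symm i))⁻¹ * v (σ.symm i)) := by
  ext i j
  by_cases h : j = c
  · subst h
    simp [rowMonomial, ht]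
  · simp [rowMonomial, h]

/-- Applying a monomial transformation to the rows of the points with index larger than `k`. -/
def tailMonomial (k : ℕ) (σ : Equiv.Perm (Fin n)) (t : Fin n → ℂ)
    (z : ℕ → Matrix (Fin n) (Fin d) ℂ) (i : ℕ) : Matrix (Fin n) (Fin d) ℂ :=
  if i ≤ k then z i else rowMonomial σ t (z i)

theorem tailMonomial_surjective (k : ℕ) (σ : Equiv.Perm (Fin n)) :
    Function.Surjective (tailMonomial (d := d) k σ 1) := by
  intro z
  refine ⟨fun i => if i ≤ k then z i else rowMonomial σ⁻¹ 1 (z i), ?_⟩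
  ext i a b
  by_cases h : i ≤ k <;> simp [tailMonomial, h, rowMonomial]

theorem tangentJoin_tailMonomial_of_le {k : ℕ} {A : Finset ℕ} (hA : ∀ i ∈ A, i ≤ k)
    (σ : Equiv.Perm (Fin n)) (t : Fin n → ℂ) (z : ℕ → Matrix (Fin n) (Fin d) ℂ) :
    tangentJoin A (tailMonomial k σ t z) = tangentJoin A z :=
  iSup_congr fun i => iSup_congr fun hi => by rw [tailMonomial, if_pos (hA i hi)]

/-- A vector lying in the spans of generically rescaled and arbitrarily permuted tangent spaces
forces the span to be everything. -/
theorem tangentJoin_eq_top_of_forall_mem {k : ℕ} {B : Finset ℕ} (hB : ∀ i ∈ B, k < i)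
    {F : (ℕ → Matrix (Fin n) (Fin d) ℂ) → ℂ} (hF : PolyOnLines F)
    {z : ℕ → Matrix (Fin n) (Fin d) ℂ} (hz : ∀ σ, F (tailMonomial k σ 1 z) ≠ 0)
    {v : Lam n d → ℂ} (hv : v ≠ 0)
    (h : ∀ σ t, F (tailMonomial k σ t z) ≠ 0 → v ∈ tangentJoin B (tailMonomial k σ t z)) :
    tangentJoin B z = ⊤ := by
  obtain ⟨S, hS⟩ := Function.ne_iff.1 hv
  rw [Pi.zero_apply] at hS
  by_contra hne
  obtain ⟨l, hl, hle⟩ := Submodule.exists_le_ker_of_lt_top _ (lt_top_iff_ne_top.2 hne)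
  refine hl (LinearMap.pi_ext' fun S' => LinearMap.ext_ring ?_)
  obtain ⟨σ, rfl⟩ := S.exists_perm_eq S'
  choose ε hε hplucker using fun S : Lam n d => exists_plucker_rowMonomial σ S
  let a (Q : Lam n d) : ℂ := l (Pi.single (Q.perm σ) 1)
  have hl_apply (w : Lam n d → ℂ) : l w = ∑ Q, w (Lam.perm σ Q) * a Q := by
    rw [LinearMap.pi_apply_eq_sum_univ l w,
      ← Equiv.sum_comp (Equiv.ofBijective _ (Lam.perm_bijective σ))]
    refine Finset.sum_congr rfl fun Q _ => ?_
    have hj : (Pi.single (Q.perm σ) 1 : Lam n d → ℂ) =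
        fun S => if Q.perm σ = S then 1 else 0 := by
      ext S
      simp [Pi.single_apply, eq_comm]
    simp only [Equiv.ofBijective_apply, smul_eq_mul, a, hj]
  let G (t : Fin n → ℂ) : ℂ := ∑ Q : Lam n d, (∏ i ∈ Q.1ᶜ, t i) * (v Q * (ε Q)⁻¹ * a Q)
  have hG : PolyOnLines G := .sum _ fun Q _ =>
    .mul (.prod _ fun i _ => .linear (LinearMap.proj (R := ℂ) (φ := fun _ => ℂ) i)) (.const _)
  have hG0 (t) : G t = 0 := by
    refine PolyOnLines.eq_zero_of_mul_eq_zero (G := fun t => F (tailMonomial k σ t z) * ∏ i, t i)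
      hG (.mul (hF.comp fun t u => ?_)
        (.prod _ fun i _ => .linear (LinearMap.proj (R := ℂ) (φ := fun _ => ℂ) i)))
      ⟨1, by simpa using hz σ⟩ (fun t => ?_) t
    · refine ⟨fun i => if i ≤ k then 0 else rowMonomial σ u (z i), fun s => ?_⟩
      ext i p q
      by_cases hi : i ≤ k
      · simp [tailMonomial, hi]
      · simp [tailMonomial, hi, rowMonomial, add_mul, mul_assoc]
    · by_cases ht : F (tailMonomial k σ t z) * ∏ i, t i = 0
      · simp [ht]
      have hFt := left_ne_zero_of_mul ht
      have ht0 (i) : t i ≠ 0 := Finset.prod_ne_zero_iff.1 (right_ne_zero_of_mul ht) i (by simp)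
      let W : Submodule ℂ (Lam n d → ℂ) :=
        { carrier := { x | ∃ w ∈ tangentJoin B z,
            ∀ Q, x Q = (∏ i ∈ Q.1, t i) * (ε Q * w (Q.perm σ)) }
          add_mem' := by
            rintro x y ⟨w, hw, hx⟩ ⟨w', hw', hy⟩
            exact ⟨w + w', add_mem hw hw', fun Q => by simp [hx, hy]; ring⟩
          zero_mem' := ⟨0, zero_mem _, by simp⟩
          smul_mem' := by
            rintro s x ⟨w, hw, hx⟩
            exact ⟨s • w, Submodule.smul_mem _ s hw, fun Q => by simp [hx]; ring⟩ }
      have hW : tangentJoin B (tailMonomial k σ t z) ≤ W := by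
        refine tangentJoin_le fun i hi c u => ?_
        refine ⟨_, pluckerCol_mem_tangentJoin z hi c
          (fun i => (t (σ.symm i))⁻¹ * u (σ.symm i)), fun Q => ?_⟩
        rw [tailMonomial, if_neg (hB i hi).not_ge, pluckerCol_apply, pluckerCol_apply,
          rowMonomial_updateCol σ ht0, hplucker]
      obtain ⟨w, hw, hvw⟩ := hW (h σ t hFt)
      have hlw : l w = 0 := hle hw
      have hGt : G t = (∏ i, t i) * l w := by
        simp only [G, hl_apply, Finset.mul_sum]
        refine Finset.sum_congr rfl fun Q _ => ?_
        rw [hvw, ← Finset.prod_mul_prod_compl Q.1 t]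
        field_simp [hε Q]
      rw [hGt, hlw, mul_zero, zero_mul]
  have hGS := hG0 fun i => if i ∈ S.1 then 0 else 1
  simp only [G] at hGS
  rw [Finset.sum_eq_single S] at hGS
  · have h₁ : ∏ i ∈ S.1ᶜ, (if i ∈ S.1 then (0 : ℂ) else 1) = 1 :=
      Finset.prod_eq_one fun i hi => by simp [Finset.mem_compl.1 hi]
    simpa [h₁, hS, hε S, a] using hGS
  · intro Q _ hQ
    have : ∃ i ∈ S.1, i ∉ Q.1 := by
      by_contra! hc
      exact hQ (Lam.eq_of_subset hc).symm
    obtain ⟨i, hi, hiQ⟩ := this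
    rw [Finset.prod_eq_zero (i := i) (by simpa using hiQ) (by simp [hi]), zero_mul]
  · simp

end Monomial

section Strictness

open Module

variable {n d : ℕ}

/-- If the increments of the generic rank stall for one step, then the intersections of a generic
tangent space with the spans of disjoint generic families coincide. -/
theorem inf_tangentJoin_le_of_genRank_eq {k : ℕ} {z : ℕ → Matrix (Fin n) (Fin d) ℂ}
    (hz : ∀ A ⊆ Finset.range (2 * k + 1), finrank ℂ (tangentJoin A z) = genRank n d A.card)
    (h : genRank n d (k + 2) + genRank n d k = 2 * genRank n d (k + 1)) :
    tangentJoin {0} z ⊓ tangentJoin (Finset.Ico 1 (k + 1)) z ≤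
      tangentJoin (Finset.Ico (k + 1) (2 * k + 1)) z := by
  have hinf (B : Finset ℕ) (hB : B ⊆ Finset.range (2 * k + 1)) (h0 : 0 ∉ B) :
      genRank n d (B.card + 1) + finrank ℂ ↥(tangentJoin {0} z ⊓ tangentJoin B z) =
        genRank n d 1 + genRank n d B.card := by
    have h₁ := Submodule.finrank_sup_add_finrank_inf_eq (tangentJoin {0} z) (tangentJoin B z)
    have hsub : {0} ∪ B ⊆ Finset.range (2 * k + 1) :=
      Finset.union_subset (by simp) hB
    rw [← tangentJoin_union, hz _ hsub, hz _ hB, hz {0} (by simp), Finset.card_singleton,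
      Finset.singleton_union, Finset.card_insert_of_notMem h0] at h₁
    exact h₁
  have heq (B B' : Finset ℕ) (hBB : B ⊆ B') (hB' : B' ⊆ Finset.range (2 * k + 1)) (h0 : 0 ∉ B')
      (hc : B.card = k) (hc' : B'.card = k + 1) :
      tangentJoin {0} z ⊓ tangentJoin B z = tangentJoin {0} z ⊓ tangentJoin B' z := by
    refine Submodule.eq_of_le_of_finrank_eq (inf_le_inf_left _ (tangentJoin_mono hBB z)) ?_
    have h₁ := hinf B (hBB.trans hB') fun h => h0 (hBB h)
    have h₂ := hinf B' hB' h0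
    rw [hc] at h₁
    rw [hc', show k + 1 + 1 = k + 2 by omega] at h₂
    omega
  have key (j : ℕ) (hj : j ≤ k) : tangentJoin {0} z ⊓ tangentJoin (Finset.Ico 1 (k + 1)) z =
      tangentJoin {0} z ⊓ tangentJoin (Finset.Ico (j + 1) (k + j + 1)) z := by
    induction j with
    | zero => rfl
    | succ j ih =>
      rw [ih (by omega), heq _ (Finset.Ico (j + 1) (k + j + 2)), ← heq]
      all_goals first
        | (intro i; simp; omega)
        | (simp; omega)
        | simp
  rw [key k le_rfl, two_mul]
  exact inf_le_right

theorem genRank_eq_choose_of_genRank_eq {k : ℕ}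
    (h : genRank n d (k + 2) + genRank n d k = 2 * genRank n d (k + 1))
    (h' : genRank n d (k + 1) < genRank n d k + genRank n d 1) : genRank n d k = n.choose d := by
  obtain ⟨F, hF, hF', hgen⟩ :=
    exists_polyOnLines_forall_finrank_eq n d (Finset.range (2 * k + 1)).powerset
  simp only [Finset.mem_powerset] at hgen
  have hcomp (σ : Equiv.Perm (Fin n)) : PolyOnLines fun z => F (tailMonomial k σ 1 z) := by
    refine hF.comp fun z y => ⟨tailMonomial k σ 1 y, fun s => ?_⟩
    ext i a b
    by_cases hi : i ≤ k <;> simp [tailMonomial, hi, rowMonomial]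
  obtain ⟨z, hz⟩ := PolyOnLines.exists_prod_ne_zero Finset.univ (fun σ _ => hcomp σ) fun σ _ => by
    obtain ⟨y, hy⟩ := hF'
    obtain ⟨x, rfl⟩ := tailMonomial_surjective k σ y
    exact ⟨x, hy⟩
  rw [Finset.prod_ne_zero_iff] at hz
  have hz (σ) : F (tailMonomial k σ 1 z) ≠ 0 := hz σ (by simp)
  have hz1 : tailMonomial k 1 1 z = z := by
    ext i a b
    by_cases hi : i ≤ k <;> simp [tailMonomial, hi, rowMonomial]
  have hgz := hgen z (by simpa only [hz1] using hz 1)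
  have hpos : tangentJoin {0} z ⊓ tangentJoin (Finset.Ico 1 (k + 1)) z ≠ ⊥ := by
    intro hbot
    have h₁ := Submodule.finrank_sup_add_finrank_inf_eq (tangentJoin {0} z)
      (tangentJoin (Finset.Ico 1 (k + 1)) z)
    have hsub : Finset.Ico 1 (k + 1) ⊆ Finset.range (2 * k + 1) := by
      intro i
      simp
      omega
    rw [hbot, finrank_bot, ← tangentJoin_union, hgz _ hsub, hgz {0} (by simp),
      hgz _ (Finset.union_subset (by simp) hsub), Finset.card_singleton,
      Finset.singleton_union, Finset.card_insert_of_notMem (by simp), Nat.card_Ico] at h₁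
    simp only [Nat.add_sub_cancel] at h₁
    omega
  obtain ⟨v, hv, hv0⟩ := Submodule.exists_mem_ne_zero_of_ne_bot hpos
  have htop : tangentJoin (Finset.Ico (k + 1) (2 * k + 1)) z = ⊤ := by
    refine tangentJoin_eq_top_of_forall_mem (k := k) (by simp; omega) hF hz hv0 fun σ t ht => ?_
    refine inf_tangentJoin_le_of_genRank_eq (hgen _ ht) h ?_
    rwa [tangentJoin_tailMonomial_of_le (by simp), tangentJoin_tailMonomial_of_le (by simp)]
  have hfin := hgz (Finset.Ico (k + 1) (2 * k + 1)) (by intro i; simp)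
  rw [htop, finrank_top, finrank_fintype_fun_eq_card, card_Lam, Nat.card_Ico,
    show 2 * k + 1 - (k + 1) = k by omega] at hfin
  exact hfin.symm

theorem genRank_mono (n d : ℕ) : Monotone (genRank n d) := by
  refine monotone_nat_of_le_succ fun k => ?_
  obtain ⟨z, hz⟩ := exists_finrank_tangentJoin_eq n d (Finset.range k)
  rw [Finset.card_range] at hz
  rw [← hz]
  refine (Submodule.finrank_mono (tangentJoin_mono (B := Finset.range (k + 1)) ?_ z)).trans ?_
  · exact Finset.range_subset_range.2 k.le_succ
  · simpa using finrank_tangentJoin_le (Finset.range (k + 1)) z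

theorem genRank_eq_mul (hd : 1 ≤ d) (hdn : d ≤ n) {N m : ℕ} (hN : N = d * (n - d) + 1)
    (hm : N * (m + N) ≤ n.choose d) : genRank n d m = m * N := by
  have h1 : genRank n d 1 = N := by rw [genRank_one hd hdn, hN]
  have hle (k) : genRank n d k ≤ k * N := hN ▸ genRank_le_mul hd hdn k
  refine (hle m).antisymm ?_
  by_contra! hlt
  obtain ⟨k, hkm, hk⟩ : ∃ k < m, genRank n d (k + 1) < genRank n d k + N := by
    by_contra! hc
    have (k : ℕ) (hk : k ≤ m) : k * N ≤ genRank n d k := by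
      induction k with
      | zero => simp
      | succ k ih =>
        have h₁ := ih (by omega)
        have h₂ := hc k (by omega)
        rw [add_mul, one_mul]
        omega
    exact absurd (this m le_rfl) (by omega)
  have hdec (j : ℕ) : genRank n d (k + j) = n.choose d ∨
      genRank n d (k + j + 1) + (j + 1) ≤ genRank n d (k + j) + N := by
    induction j with
    | zero => right; simpa using hk
    | succ j ih =>
      have hmono := genRank_mono n d
      have hub := genRank_le_choose n d
      by_cases heq : genRank n d (k + j) = n.choose d
      · left
        exact (hub _).antisymm (heq ▸ hmono (by omega))
      · have ih := ih.resolve_left heq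
        have hconc := genRank_concave n d (k + j)
        have hstrict : ¬ genRank n d (k + j + 2) + genRank n d (k + j) =
            2 * genRank n d (k + j + 1) := fun h =>
          heq (genRank_eq_choose_of_genRank_eq h (by omega))
        right
        rw [show k + (j + 1) + 1 = k + j + 2 by omega, show k + (j + 1) = k + j + 1 by omega]
        omega
  have hfull : genRank n d (k + N) = n.choose d := by
    refine (hdec N).resolve_right fun h => ?_
    have := genRank_mono n d (show k + N ≤ k + N + 1 by omega)
    omega
  have hfull' := hle (k + N)
  have : (k + N) * N < N * (m + N) := by
    rw [mul_comm]
    exact Nat.mul_lt_mul_of_pos_left (by omega) (by omega)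
  omega

end Strictness

theorem stmt_8 (n d : ℕ) (hd : 1 ≤ d) (hdn : d ≤ n)
    (N : ℕ) (hN : N = d * (n - d) + 1) :
    zDim (GrassCone n d) = (N : WithBot ℕ∞) ∧
    ∀ m : ℕ, 1 ≤ m → N * (m + N) ≤ Nat.choose n d →
      zDim (secant m (GrassCone n d)) = ((m * N : ℕ) : WithBot ℕ∞) := by
  constructor
  · have h := zDim_secant_mem_Icc hd hdn 1
    rw [secant_one_grassCone, genRank_one hd hdn, one_mul, ← hN] at h
    exact h.2.antisymm h.1
  · intro m _ hm
    have h := zDim_secant_mem_Icc hd hdn m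
    rw [genRank_eq_mul hd hdn hN hm, ← hN] at h
    exact h.2.antisymm h.1
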